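/- arXiv:2511.18190 — 2 statements merged into one kernel-verified Lean document; each statement's English description precedes it below -/
import Mathlib

section
/- Let n, k be integers with 4 ≤ k < n and 3k ≥ 2(n+1). Let M ⊆ ℂ^n be the set of points z = (z₁,…,z_n), with z_j = x_j + i y_j, satisfying: y_s = 0 for s = 2,…,k−1; z_t = \bar z₁ (x_{2(t−k+2)} + i x_{2(t−k+2)+1}) for t = k,…,n−2; z_{n−1} = \bar z₁²; and z_n = \bar z₁ (z₁ + x₂ + i x₃). Then for all sufficiently small ε > 0, the compact set K_ε = { z ∈ M : |z₁| ≤ ε and |x_s| ≤ ε for s = 2,…,k−1 } is polynomially convex and satisfies 𝒫(K_ε) = 𝒞(K_ε); in particular M is locally polynomially convex at 0. -/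
open Complex Metric

noncomputable section

/-- A compact set `K ⊆ ℂⁿ` is polynomially convex: every point outside `K` is separated
from `K` by a holomorphic polynomial. -/
def IsPolyConvex {n : ℕ} (K : Set (Fin n → ℂ)) : Prop :=
  ∀ w : Fin n → ℂ, w ∉ K → ∃ P : MvPolynomial (Fin n) ℂ,
    ∀ z ∈ K, ‖MvPolynomial.eval z P‖ < ‖MvPolynomial.eval w P‖

/-- `𝒫(K) = 𝒞(K)`: every continuous function on `K ⊆ ℂⁿ` is a uniform limit on `K` of
(restrictions of) holomorphic polynomials. -/
def PolyDenseInC {n : ℕ} (K : Set (Fin n → ℂ)) : Prop :=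
  ∀ g : K → ℂ, Continuous g → ∀ ε : ℝ, 0 < ε →
    ∃ P : MvPolynomial (Fin n) ℂ, ∀ z : K, ‖MvPolynomial.eval (z : Fin n → ℂ) P - g z‖ < ε

/-- The star subalgebra of functions which, together with their conjugates, are polynomials. -/
def starPoly {n : ℕ} (K : Set (Fin n → ℂ)) : StarSubalgebra ℂ C(K, ℂ) where
  carrier := {f | ∃ P Q : MvPolynomial (Fin n) ℂ, ∀ z : K,
    f z = MvPolynomial.eval (z : Fin n → ℂ) P ∧
      (starRingEnd ℂ) (f z) = MvPolynomial.eval (z : Fin n → ℂ) Q}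
  mul_mem' := by
    rintro f g ⟨P, Q, h⟩ ⟨P', Q', h'⟩
    refine ⟨P * P', Q * Q', fun z => ⟨?_, ?_⟩⟩
    · simp [(h z).1, (h' z).1]
    · rw [map_mul, ← (h z).2, ← (h' z).2]; simp
  add_mem' := by
    rintro f g ⟨P, Q, h⟩ ⟨P', Q', h'⟩
    refine ⟨P + P', Q + Q', fun z => ⟨?_, ?_⟩⟩
    · simp [(h z).1, (h' z).1]
    · rw [map_add, ← (h z).2, ← (h' z).2]; simp
  algebraMap_mem' := by
    intro r
    exact ⟨MvPolynomial.C r, MvPolynomial.C ((starRingEnd ℂ) r), fun z => by simp⟩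
  star_mem' := by
    rintro f ⟨P, Q, h⟩
    refine ⟨Q, P, fun z => ⟨?_, ?_⟩⟩
    · rw [← (h z).2]; simp
    · rw [← (h z).1]; simp

lemma polyDense_of_sep {n : ℕ} {K : Set (Fin n → ℂ)} (hc : IsCompact K)
    (hs : ∀ z ∈ K, ∀ z' ∈ K, z ≠ z' → ∃ P Q : MvPolynomial (Fin n) ℂ,
      (∀ u ∈ K, (starRingEnd ℂ) (MvPolynomial.eval u P) = MvPolynomial.eval u Q) ∧
      MvPolynomial.eval z P ≠ MvPolynomial.eval z' P) : PolyDenseInC K := by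
  have : CompactSpace K := isCompact_iff_compactSpace.mp hc
  have hsep : (starPoly K).SeparatesPoints := by
    intro z z' hne
    obtain ⟨P, Q, h1, h2⟩ := hs z z.2 z' z'.2 (fun h => hne (Subtype.ext h))
    have hcont : Continuous (fun u : K => MvPolynomial.eval (u : Fin n → ℂ) P) :=
      (MvPolynomial.continuous_eval P).comp continuous_subtype_val
    exact ⟨_, ⟨⟨_, hcont⟩, ⟨P, Q, fun u => ⟨rfl, h1 u u.2⟩⟩, rfl⟩, h2⟩
  have htop := ContinuousMap.starSubalgebra_topologicalClosure_eq_top_of_separatesPoints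
    (starPoly K) hsep
  intro g hg ε hε
  have hmem : (⟨g, hg⟩ : C(K, ℂ)) ∈ (starPoly K).topologicalClosure := by
    rw [htop]; trivial
  have hmem' : (⟨g, hg⟩ : C(K, ℂ)) ∈ closure ((starPoly K : Set C(K, ℂ))) := hmem
  obtain ⟨f, ⟨P, Q, hf⟩, hd⟩ := Metric.mem_closure_iff.mp hmem' ε hε
  refine ⟨P, fun z => ?_⟩
  rw [← (hf z).1, ← dist_eq_norm, dist_comm]
  have hle := ContinuousMap.dist_apply_le_dist (f := (⟨g, hg⟩ : C(K, ℂ))) (g := f) z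
  exact lt_of_le_of_lt hle hd

lemma polyConvex_of_dense {n : ℕ} {K : Set (Fin n → ℂ)} (hc : IsCompact K)
    (hd : PolyDenseInC K) : IsPolyConvex K := by
  intro w hw
  obtain ⟨C, hC⟩ := hc.isBounded.exists_norm_le
  set B : ℝ := |C| + ‖w‖ + 1 with hB
  have hBpos : 0 < B := by positivity
  have hCB : ∀ z ∈ K, ∀ j, ‖z j - w j‖ ≤ B := by
    intro z hz j
    have h1 := norm_le_pi_norm z j
    have h2 := norm_le_pi_norm w j
    have h3 := hC z hz
    have h4 := norm_sub_le (z j) (w j)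
    have h5 := le_abs_self C
    linarith
  let S : (Fin n → ℂ) → ℂ := fun z => ∑ j, (starRingEnd ℂ) (z j - w j) * (z j - w j)
  have hS : ∀ z ∈ K, S z ≠ 0 := by
    intro z hz h0
    apply hw
    have : S z = ((∑ j, Complex.normSq (z j - w j) : ℝ) : ℂ) := by
      simp only [S]
      push_cast
      exact Finset.sum_congr rfl fun j _ => by rw [mul_comm, Complex.mul_conj]
    rw [this] at h0
    have h0' : (∑ j, Complex.normSq (z j - w j) : ℝ) = 0 := by exact_mod_cast h0
    rw [Finset.sum_eq_zero_iff_of_nonneg (fun j _ => Complex.normSq_nonneg _)] at h0'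
    have : z = w := by
      funext j
      have := h0' j (Finset.mem_univ j)
      rw [Complex.normSq_eq_zero] at this
      exact sub_eq_zero.mp this
    rwa [← this]
  have hj : ∀ j, Continuous (fun z : K => (z : Fin n → ℂ) j - w j) := fun j =>
    ((continuous_apply j).comp continuous_subtype_val).sub continuous_const
  have hcont : ∀ j, Continuous (fun z : K => (starRingEnd ℂ) ((z : Fin n → ℂ) j - w j) / S z) := by
    intro j
    refine Continuous.div ?_ ?_ (fun z => hS z z.2)
    · exact Complex.continuous_conj.comp (hj j)
    · refine continuous_finsetSum _ fun i _ => ?_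
      exact (Complex.continuous_conj.comp (hj i)).mul (hj i)
  have hη : 0 < 1 / (2 * B * (n + 1)) := by positivity
  choose P hP using fun j => hd _ (hcont j) _ hη
  refine ⟨1 - ∑ j, P j * (MvPolynomial.X j - MvPolynomial.C (w j)), fun z hz => ?_⟩
  have e1 : MvPolynomial.eval w
      (1 - ∑ j, P j * (MvPolynomial.X j - MvPolynomial.C (w j))) = 1 := by
    simp
  rw [e1, norm_one]
  have e2 : MvPolynomial.eval z
      (1 - ∑ j, P j * (MvPolynomial.X j - MvPolynomial.C (w j))) =
      ∑ j, ((starRingEnd ℂ) (z j - w j) / S z - MvPolynomial.eval z (P j)) * (z j - w j) := by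
    have : ∑ j, ((starRingEnd ℂ) (z j - w j) / S z) * (z j - w j) = 1 := by
      have h : S z / S z = 1 := div_self (hS z hz)
      rw [← h]
      conv_rhs => rw [show S z / S z = (∑ j, (starRingEnd ℂ) (z j - w j) * (z j - w j)) / S z
        from rfl, Finset.sum_div]
      exact Finset.sum_congr rfl fun j _ => by ring
    have h' : ∀ j, ((starRingEnd ℂ) (z j - w j) / S z - MvPolynomial.eval z (P j)) * (z j - w j) =
        ((starRingEnd ℂ) (z j - w j) / S z) * (z j - w j) -
          MvPolynomial.eval z (P j) * (z j - w j) := fun j => by ring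
    rw [Finset.sum_congr rfl fun j _ => h' j, Finset.sum_sub_distrib, this]
    simp only [map_sub, map_one, map_sum, map_mul, MvPolynomial.eval_X, MvPolynomial.eval_C]
  rw [e2]
  refine lt_of_le_of_lt (norm_sum_le _ _) ?_
  have : ∀ j ∈ Finset.univ, ‖((starRingEnd ℂ) (z j - w j) / S z - MvPolynomial.eval z (P j)) *
      (z j - w j)‖ ≤ 1 / (2 * B * (n + 1)) * B := by
    intro j _
    rw [norm_mul]
    have h1 := hP j ⟨z, hz⟩
    rw [norm_sub_rev] at h1
    exact mul_le_mul h1.le (hCB z hz j) (norm_nonneg _) hη.le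
  refine lt_of_le_of_lt (Finset.sum_le_sum this) ?_
  rw [Finset.sum_const, Finset.card_univ, Fintype.card_fin, nsmul_eq_mul]
  have : (n : ℝ) * (1 / (2 * B * (n + 1)) * B) = n / (2 * (n + 1)) := by
    field_simp
  rw [this, div_lt_one (by positivity)]
  have : (0 : ℝ) ≤ n := Nat.cast_nonneg n
  linarith

/-- Let `4 ≤ k < n` with `3k ≥ 2(n+1)`, and let `M ⊆ ℂⁿ` be defined by
Coffman's normal form (written here with 1-based indices `z_1, …, z_n` translated to the
0-based coordinates `z ⟨j-1,_⟩`): `y_s = 0` for `s = 2,…,k−1`;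
`z_t = z̄₁ (x_{2(t−k+2)} + i x_{2(t−k+2)+1})` for `t = k,…,n−2`; `z_{n−1} = z̄₁²`; and
`z_n = z̄₁ (z₁ + x₂ + i x₃)`. Then for all sufficiently small `ε > 0` the compact set
`K_ε = {z ∈ M : |z₁| ≤ ε, |x_s| ≤ ε for s = 2,…,k−1}` is polynomially convex and satisfies
`𝒫(K_ε) = 𝒞(K_ε)`; in particular `M` is locally polynomially convex at `0`. -/
theorem coffman_normal_form_locally_polyConvex (n k : ℕ) (hk : 4 ≤ k) (hkn : k < n)
    (h3 : 2 * (n + 1) ≤ 3 * k)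
    (M : Set (Fin n → ℂ))
    (hM : M = { z : Fin n → ℂ |
      (∀ s : ℕ, ∀ _ : 2 ≤ s ∧ s ≤ k - 1, (z ⟨s - 1, by omega⟩).im = 0) ∧
      (∀ t : ℕ, ∀ _ : k ≤ t ∧ t ≤ n - 2,
        z ⟨t - 1, by omega⟩ = (starRingEnd ℂ) (z ⟨0, by omega⟩) *
          (((z ⟨2 * (t - k + 2) - 1, by omega⟩).re : ℂ) +
            Complex.I * ((z ⟨2 * (t - k + 2) + 1 - 1, by omega⟩).re : ℂ))) ∧
      z ⟨n - 1 - 1, by omega⟩ = (starRingEnd ℂ) (z ⟨0, by omega⟩) ^ 2 ∧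
      z ⟨n - 1, by omega⟩ = (starRingEnd ℂ) (z ⟨0, by omega⟩) *
        (z ⟨0, by omega⟩ + ((z ⟨1, by omega⟩).re : ℂ) + Complex.I * ((z ⟨2, by omega⟩).re : ℂ)) })
    (K : ℝ → Set (Fin n → ℂ))
    (hK : ∀ ε : ℝ, K ε = { z ∈ M | ‖z ⟨0, by omega⟩‖ ≤ ε ∧
      ∀ s : ℕ, ∀ _ : 2 ≤ s ∧ s ≤ k - 1, |(z ⟨s - 1, by omega⟩).re| ≤ ε }) :
    ∃ ε₀ > (0:ℝ), ∀ ε : ℝ, 0 < ε → ε ≤ ε₀ →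
      IsPolyConvex (K ε) ∧ PolyDenseInC (K ε) := by
  refine ⟨1, one_pos, fun ε hε _ => ?_⟩
  -- a convenient description of membership
  have hmem : ∀ z ∈ K ε,
      (∀ i : Fin n, 1 ≤ i.1 → i.1 ≤ k - 2 → (z i).im = 0 ∧ |(z i).re| ≤ ε) ∧
      (∀ t : ℕ, ∀ _ : k ≤ t ∧ t ≤ n - 2,
        z ⟨t - 1, by omega⟩ = (starRingEnd ℂ) (z ⟨0, by omega⟩) *
          (((z ⟨2 * (t - k + 2) - 1, by omega⟩).re : ℂ) +
            Complex.I * ((z ⟨2 * (t - k + 2) + 1 - 1, by omega⟩).re : ℂ))) ∧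
      z ⟨n - 1 - 1, by omega⟩ = (starRingEnd ℂ) (z ⟨0, by omega⟩) ^ 2 ∧
      z ⟨n - 1, by omega⟩ = (starRingEnd ℂ) (z ⟨0, by omega⟩) *
        (z ⟨0, by omega⟩ + ((z ⟨1, by omega⟩).re : ℂ) + Complex.I * ((z ⟨2, by omega⟩).re : ℂ)) ∧
      ‖z ⟨0, by omega⟩‖ ≤ ε := by
    intro z hz
    rw [hK, hM] at hz
    obtain ⟨⟨h1, h2, h4, h5⟩, h6, h7⟩ := hz
    refine ⟨fun i hi hi' => ?_, h2, h4, h5, h6⟩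
    have a := h1 (i.1 + 1) ⟨by omega, by omega⟩
    have b := h7 (i.1 + 1) ⟨by omega, by omega⟩
    exact ⟨a, b⟩
  have hclosed : IsClosed (K ε) := by
    rw [hK, hM]
    have cc : Continuous (starRingEnd ℂ) := Complex.continuous_conj
    simp only [Set.ofPred_and, Set.ofPred_forall]
    refine IsClosed.inter (IsClosed.inter ?_ (IsClosed.inter ?_ (IsClosed.inter ?_ ?_)))
      (IsClosed.inter ?_ ?_)
    · exact isClosed_iInter fun s => isClosed_iInter fun hs =>
        isClosed_eq (by fun_prop) (by fun_prop)
    · exact isClosed_iInter fun s => isClosed_iInter fun hs =>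
        isClosed_eq (by fun_prop) (by fun_prop)
    · exact isClosed_eq (by fun_prop) (by fun_prop)
    · exact isClosed_eq (by fun_prop) (by fun_prop)
    · exact isClosed_le (by fun_prop) (by fun_prop)
    · exact isClosed_iInter fun s => isClosed_iInter fun hs =>
        isClosed_le (by fun_prop) (by fun_prop)
  have hcases : ∀ i : Fin n, i = ⟨0, by omega⟩ ∨ (1 ≤ i.1 ∧ i.1 ≤ k - 2) ∨
      (∃ t : ℕ, ∃ h : k ≤ t ∧ t ≤ n - 2, i = ⟨t - 1, by omega⟩) ∨
      i = ⟨n - 1 - 1, by omega⟩ ∨ i = ⟨n - 1, by omega⟩ := by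
    intro i
    by_cases h0 : i.1 = 0
    · left; exact Fin.ext h0
    by_cases h1 : i.1 ≤ k - 2
    · right; left; omega
    by_cases h2 : i.1 = n - 1
    · right; right; right; right; exact Fin.ext h2
    by_cases h3 : i.1 = n - 1 - 1
    · right; right; right; left; exact Fin.ext h3
    right; right; left
    exact ⟨i.1 + 1, ⟨by omega, by omega⟩, Fin.ext (by simp)⟩
  have hcomp : IsCompact (K ε) := by
    refine Metric.isCompact_of_isClosed_isBounded hclosed ?_
    rw [isBounded_iff_forall_norm_le]
    refine ⟨ε + ε * (ε + ε) + ε ^ 2 + ε * (ε + ε + ε), fun z hz => ?_⟩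
    obtain ⟨h1, h2, h4, h5, h6⟩ := hmem z hz
    have hre : ∀ i : Fin n, 1 ≤ i.1 → i.1 ≤ k - 2 → ‖((z i).re : ℂ)‖ ≤ ε := by
      intro i hi hi'
      rw [Complex.norm_real]
      exact (h1 i hi hi').2
    have hc : ‖(starRingEnd ℂ) (z ⟨0, by omega⟩)‖ ≤ ε := by rw [Complex.norm_conj]; exact h6
    have p1 : 0 ≤ ε * (ε + ε) := by positivity
    have p2 : 0 ≤ ε ^ 2 := by positivity
    have p3 : 0 ≤ ε * (ε + ε + ε) := by positivity
    rw [pi_norm_le_iff_of_nonneg (by positivity)]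
    intro i
    rcases hcases i with rfl | h | ⟨t, ht, rfl⟩ | rfl | rfl
    · linarith
    · have e : z i = ((z i).re : ℂ) := Complex.ext (by simp) (by simp [(h1 i h.1 h.2).1])
      rw [e]
      linarith [hre i h.1 h.2]
    · rw [h2 t ht, norm_mul]
      have a := hre ⟨2 * (t - k + 2) - 1, by omega⟩ (by simp; omega) (by simp; omega)
      have b := hre ⟨2 * (t - k + 2) + 1 - 1, by omega⟩ (by simp; omega) (by simp; omega)
      have : ‖((z ⟨2 * (t - k + 2) - 1, by omega⟩).re : ℂ) +
            Complex.I * ((z ⟨2 * (t - k + 2) + 1 - 1, by omega⟩).re : ℂ)‖ ≤ ε + ε := by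
        refine (norm_add_le _ _).trans ?_
        rw [norm_mul, Complex.norm_I, one_mul]
        exact add_le_add a b
      have := mul_le_mul hc this (norm_nonneg _) hε.le
      linarith
    · rw [h4, norm_pow]
      have := pow_le_pow_left₀ (norm_nonneg _) hc 2
      linarith
    · rw [h5, norm_mul]
      have a := hre ⟨1, by omega⟩ (by simp) (by simp; omega)
      have b := hre ⟨2, by omega⟩ (by simp) (by simp; omega)
      have : ‖z ⟨0, by omega⟩ + ((z ⟨1, by omega⟩).re : ℂ) +
          Complex.I * ((z ⟨2, by omega⟩).re : ℂ)‖ ≤ ε + ε + ε := by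
        refine (norm_add_le _ _).trans ?_
        rw [norm_mul, Complex.norm_I, one_mul]
        exact add_le_add ((norm_add_le _ _).trans (add_le_add h6 a)) b
      have := mul_le_mul hc this (norm_nonneg _) hε.le
      linarith
  have hconj : ∀ z ∈ K ε, ∀ i : Fin n, 1 ≤ i.1 → i.1 ≤ k - 2 →
      (starRingEnd ℂ) (z i) = z i := by
    intro z hz i hi hi'
    exact Complex.conj_eq_iff_im.mpr ((hmem z hz).1 i hi hi').1
  have hreal : ∀ z ∈ K ε, ∀ i : Fin n, 1 ≤ i.1 → i.1 ≤ k - 2 → ((z i).re : ℂ) = z i := by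
    intro z hz i hi hi'
    exact Complex.conj_eq_iff_re.mp (hconj z hz i hi hi')
  -- the polynomials `w = z₁ + x₂ + i x₃`, `|w|²` and `|w|² w̄`
  let i0 : Fin n := ⟨0, by omega⟩
  let i1 : Fin n := ⟨1, by omega⟩
  let i2 : Fin n := ⟨2, by omega⟩
  let a : Fin n := ⟨n - 1 - 1, by omega⟩
  let b : Fin n := ⟨n - 1, by omega⟩
  let cb : MvPolynomial (Fin n) ℂ := MvPolynomial.X i1 - MvPolynomial.C Complex.I * MvPolynomial.X i2
  let W : MvPolynomial (Fin n) ℂ :=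
    MvPolynomial.X i0 + MvPolynomial.X i1 + MvPolynomial.C Complex.I * MvPolynomial.X i2
  let N : MvPolynomial (Fin n) ℂ := MvPolynomial.X b + cb * W
  let G : MvPolynomial (Fin n) ℂ :=
    W * MvPolynomial.X a + 2 * cb * MvPolynomial.X b + cb ^ 2 * W
  let ω : (Fin n → ℂ) → ℂ := fun z => z i0 + z i1 + Complex.I * z i2
  have hωc : ∀ z ∈ K ε, (starRingEnd ℂ) (ω z) =
      (starRingEnd ℂ) (z i0) + z i1 - Complex.I * z i2 := by
    intro z hz
    simp only [ω, map_add, map_mul, Complex.conj_I]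
    rw [hconj z hz i1 (by simp [i1]) (by simp [i1]; omega),
      hconj z hz i2 (by simp [i2]) (by simp [i2]; omega)]
    ring
  have hb : ∀ z ∈ K ε, z b = (starRingEnd ℂ) (z i0) * ω z := by
    intro z hz
    have := (hmem z hz).2.2.2.1
    rw [hreal z hz ⟨1, by omega⟩ (by simp) (by simp; omega),
      hreal z hz ⟨2, by omega⟩ (by simp) (by simp; omega)] at this
    exact this
  have ha : ∀ z ∈ K ε, z a = (starRingEnd ℂ) (z i0) ^ 2 := fun z hz => (hmem z hz).2.2.1
  have hN : ∀ z ∈ K ε, MvPolynomial.eval z N = ω z * (starRingEnd ℂ) (ω z) := by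
    intro z hz
    rw [hωc z hz]
    simp only [N, cb, W, map_add, map_sub, map_mul, MvPolynomial.eval_X, MvPolynomial.eval_C]
    rw [hb z hz]
    simp only [ω]
    ring
  have hG : ∀ z ∈ K ε, MvPolynomial.eval z G = ω z * (starRingEnd ℂ) (ω z) ^ 2 := by
    intro z hz
    rw [hωc z hz]
    simp only [G, cb, W, map_add, map_sub, map_mul, map_pow, MvPolynomial.eval_X,
      MvPolynomial.eval_C, map_ofNat]
    rw [hb z hz, ha z hz]
    simp only [ω]
    ring
  have hW : ∀ z, MvPolynomial.eval z W = ω z := by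
    intro z
    simp [W, ω]
  have hdense : PolyDenseInC (K ε) := by
    refine polyDense_of_sep hcomp fun z hz z' hz' hne => ?_
    by_contra hcon
    push Not at hcon
    apply hne
    have hx : ∀ i : Fin n, 1 ≤ i.1 → i.1 ≤ k - 2 → z i = z' i := by
      intro i hi hi'
      have := hcon (MvPolynomial.X i) (MvPolynomial.X i)
        (fun u hu => by simpa using hconj u hu i hi hi')
      simpa using this
    have hNe := hcon N N (fun u hu => by rw [hN u hu]; simp [mul_comm])
    have hGe := hcon G (N * W) (fun u hu => by
      rw [map_mul, hN u hu, hG u hu, hW]; simp; ring)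
    rw [hN z hz, hN z' hz'] at hNe
    rw [hG z hz, hG z' hz'] at hGe
    have hω : ω z = ω z' := by
      by_cases h0 : ω z' = 0
      · rw [h0] at hNe ⊢
        simpa using hNe
      · have h1 : ω z' * (starRingEnd ℂ) (ω z') ≠ 0 := by
          simpa using h0
        have h2 : (ω z' * (starRingEnd ℂ) (ω z')) * (starRingEnd ℂ) (ω z) =
            (ω z' * (starRingEnd ℂ) (ω z')) * (starRingEnd ℂ) (ω z') := by
          calc _ = ω z * (starRingEnd ℂ) (ω z) ^ 2 := by rw [← hNe]; ring
            _ = ω z' * (starRingEnd ℂ) (ω z') ^ 2 := hGe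
            _ = (ω z' * (starRingEnd ℂ) (ω z')) * (starRingEnd ℂ) (ω z') := by ring
        exact (starRingEnd ℂ).injective (mul_left_cancel₀ h1 h2)
    have h0 : z i0 = z' i0 := by
      simp only [ω] at hω
      rw [hx i1 (by simp [i1]) (by simp [i1]; omega),
        hx i2 (by simp [i2]) (by simp [i2]; omega)] at hω
      simpa using hω
    funext i
    rcases hcases i with rfl | h | ⟨t, ht, rfl⟩ | rfl | rfl
    · exact h0
    · exact hx i h.1 h.2
    · rw [(hmem z hz).2.1 t ht, (hmem z' hz').2.1 t ht,
        hx ⟨2 * (t - k + 2) - 1, by omega⟩ (by simp; omega) (by simp; omega),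
        hx ⟨2 * (t - k + 2) + 1 - 1, by omega⟩ (by simp; omega) (by simp; omega)]
      congr 2
    · exact (ha z hz).trans ((congrArg (fun u => (starRingEnd ℂ) u ^ 2) h0).trans (ha z' hz').symm)
    · refine (hb z hz).trans (Eq.trans ?_ (hb z' hz').symm)
      rw [h0, hω]
  exact ⟨polyConvex_of_dense hcomp hdense, hdense⟩
end
end

section
/- Let γ > 1/2, r > 0, and let F : \bar{D}_r(0) → ℂ be a smooth function with F(0) = 0, both first-order partial derivatives of F vanishing at 0, and ‖F‖_{C²(\bar{D}_r(0))} ≤ (2γ−1)³/(2¹⁴ γ³). Let f : \bar{D}_r(0) → ℂ be the solution of γ f² + (ζ + 2γ\bar ζ) f − F(ζ,\bar ζ) = 0 given by f(ζ,\bar ζ) = −((ζ + 2γ\bar ζ)/(2γ))(1 − √(1 + 4γ F(ζ,\bar ζ)/(ζ + 2γ\bar ζ)²)) for ζ ≠ 0 (principal branch) and f(0) = 0. Then the Wirtinger derivatives of f satisfy |f_z(ζ,\bar ζ)| ≤ (2γ−1)/(2⁹ γ²) and |f_{\bar z}(ζ,\bar ζ)| ≤ (2γ−1)/(2⁹ γ²)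 for 0 < |ζ| < r, and consequently f is Lipschitz with |f(ζ₁,\bar ζ₁) − f(ζ₂,\bar ζ₂)| ≤ ((2γ−1)/(32γ²)) |ζ₁ − ζ₂| for all ζ₁, ζ₂ ∈ \bar{D}_r(0). -/
open Complex Metric ComplexConjugate

noncomputable section

/-- Directional partial derivative (over ℝ) of `F : ℂ → ℂ` along `v`;
`pd 1 F = F_x` and `pd Complex.I F = F_y`. -/
def pd (v : ℂ) (F : ℂ → ℂ) : ℂ → ℂ := fun z => fderiv ℝ F z v

/-- `B` is a bound for all partial derivatives of order `≤ 2` of `F` (w.r.t. the real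
coordinates `x, y`) on the set `s`; i.e. `‖F‖_{C²(s)} ≤ B`. -/
def IsC2Bound (F : ℂ → ℂ) (s : Set ℂ) (B : ℝ) : Prop :=
  ∀ z ∈ s, ‖F z‖ ≤ B ∧ ‖pd 1 F z‖ ≤ B ∧ ‖pd Complex.I F z‖ ≤ B ∧
    ‖pd 1 (pd 1 F) z‖ ≤ B ∧ ‖pd Complex.I (pd 1 F) z‖ ≤ B ∧
    ‖pd 1 (pd Complex.I F) z‖ ≤ B ∧ ‖pd Complex.I (pd Complex.I F) z‖ ≤ B

lemma aux_opnorm (L : ℂ →L[ℝ] ℂ) (M : ℝ) (h1 : ‖L 1‖ ≤ M) (hI : ‖L Complex.I‖ ≤ M) :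
    ‖L‖ ≤ 2 * M := by
  have hM : 0 ≤ M := (norm_nonneg _).trans h1
  refine L.opNorm_le_bound (by positivity) fun v => ?_
  have hv : v = v.re • (1:ℂ) + v.im • Complex.I := by
    apply Complex.ext <;> simp
  have e : L v = v.re • L 1 + v.im • L Complex.I := by
    conv_lhs => rw [hv]
    rw [map_add, map_smul, map_smul]
  rw [e]
  have a1 := Complex.abs_re_le_norm v
  have a2 := Complex.abs_im_le_norm v
  calc _ ≤ ‖v.re • L 1‖ + ‖v.im • L Complex.I‖ := norm_add_le _ _
    _ = |v.re| * ‖L 1‖ + |v.im| * ‖L Complex.I‖ := by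
        rw [norm_smul, norm_smul, Real.norm_eq_abs, Real.norm_eq_abs]
    _ ≤ ‖v‖ * M + ‖v‖ * M := by gcongr
    _ = _ := by ring

lemma aux_pd_bound (F : ℂ → ℂ) (r B : ℝ) (hr : 0 < r)
    (hF : ContDiffOn ℝ (⊤ : ℕ∞) F (closedBall (0 : ℂ) r)) (e : ℂ)
    (h0 : pd e F 0 = 0)
    (h1 : ∀ z ∈ closedBall (0 : ℂ) r, ‖pd 1 (pd e F) z‖ ≤ B)
    (h2 : ∀ z ∈ closedBall (0 : ℂ) r, ‖pd Complex.I (pd e F) z‖ ≤ B)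
    (z : ℂ) (hz : z ∈ ball (0 : ℂ) r) : ‖pd e F z‖ ≤ 2 * B * ‖z‖ := by
  have key := (convex_ball (0:ℂ) r).norm_image_sub_le_of_norm_fderiv_le (𝕜 := ℝ) (f := pd e F)
    (C := 2 * B) (x := 0) (y := z) ?_ ?_ (by simpa using hr) hz
  · simpa [h0] using key
  · intro x hx
    have hc : ContDiffAt ℝ (⊤ : ℕ∞) F x :=
      hF.contDiffAt (Filter.mem_of_superset (isOpen_ball.mem_nhds hx) ball_subset_closedBall)
    have hd : DifferentiableAt ℝ (fderiv ℝ F) x :=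
      (hc.fderiv_right (m := 1) (by exact WithTop.coe_le_coe.2 le_top)).differentiableAt (by simp)
    unfold pd
    fun_prop
  · intro x hx
    exact aux_opnorm _ _ (h1 x (ball_subset_closedBall hx)) (h2 x (ball_subset_closedBall hx))

lemma aux_F_bound (F : ℂ → ℂ) (r B : ℝ) (hr : 0 < r)
    (hF : ContDiffOn ℝ (⊤ : ℕ∞) F (closedBall (0 : ℂ) r)) (hF0 : F 0 = 0)
    (h1 : ∀ z ∈ ball (0 : ℂ) r, ‖pd 1 F z‖ ≤ 2 * B * ‖z‖)
    (h2 : ∀ z ∈ ball (0 : ℂ) r, ‖pd Complex.I F z‖ ≤ 2 * B * ‖z‖) (hB : 0 ≤ B)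
    (z : ℂ) (hz : z ∈ closedBall (0 : ℂ) r) : ‖F z‖ ≤ 4 * B * ‖z‖ ^ 2 := by
  have main : ∀ z ∈ ball (0 : ℂ) r, ‖F z‖ ≤ 4 * B * ‖z‖ ^ 2 := by
    intro z hz
    have hz' : ‖z‖ < r := by simpa using hz
    have key := (convex_closedBall (0:ℂ) ‖z‖).norm_image_sub_le_of_norm_fderiv_le (𝕜 := ℝ)
      (f := F) (C := 4 * B * ‖z‖) (x := 0) (y := z) ?_ ?_ (by simp) (by simp)
    · simp only [hF0, sub_zero] at key
      linarith [key]
    · intro x hx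
      have hx' : ‖x‖ ≤ ‖z‖ := by simpa using hx
      have hxr : x ∈ ball (0:ℂ) r := by simp; linarith
      have hc : ContDiffAt ℝ (⊤ : ℕ∞) F x :=
        hF.contDiffAt (Filter.mem_of_superset (isOpen_ball.mem_nhds hxr) ball_subset_closedBall)
      exact hc.differentiableAt (by simp)
    · intro x hx
      have hx' : ‖x‖ ≤ ‖z‖ := by simpa using hx
      have hxr : x ∈ ball (0:ℂ) r := by simp; linarith
      have := aux_opnorm (fderiv ℝ F x) (2 * B * ‖x‖) (h1 x hxr) (h2 x hxr)
      nlinarith [mul_le_mul_of_nonneg_left hx' hB]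
  rw [← closure_ball (0:ℂ) hr.ne'] at hz
  have hc : ContinuousOn F (closedBall (0:ℂ) r) := hF.continuousOn
  refine ContinuousWithinAt.closure_le hz (f := fun z => ‖F z‖)
    (g := fun z => 4 * B * ‖z‖ ^ 2) ?_ ?_ main
  · rw [closure_ball (0:ℂ) hr.ne'] at hz
    exact ((hc z hz).mono ball_subset_closedBall).norm
  · exact (by fun_prop : Continuous fun z : ℂ => 4 * B * ‖z‖ ^ 2).continuousWithinAt

lemma aux_sqrt (u s : ℂ) (hs : s = (1 + u) ^ ((1:ℂ)/2)) :
    s ^ 2 = 1 + u ∧ ‖s - 1‖ ≤ ‖u‖ := by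
  have h2 : s ^ 2 = 1 + u := by
    rw [hs]
    have := Complex.cpow_nat_inv_pow (1 + u) (n := 2) (by norm_num)
    simpa using this
  refine ⟨h2, ?_⟩
  have hre : 0 ≤ s.re := by
    by_cases hu : 1 + u = 0
    · rw [hu] at h2
      have : s = 0 := by simpa using h2
      simp [this]
    · rw [hs, Complex.cpow_def_of_ne_zero hu, Complex.exp_re]
      apply mul_nonneg (Real.exp_pos _).le
      have e : (Complex.log (1 + u) * (1/2)).im = (1+u).arg / 2 := by
        rw [show (1/2 : ℂ) = ((1/2 : ℝ) : ℂ) by norm_num, Complex.im_mul_ofReal, Complex.log_im]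
        ring
      rw [e]
      have h1 := Complex.arg_le_pi (1+u)
      have h3 := Complex.neg_pi_lt_arg (1+u)
      exact Real.cos_nonneg_of_neg_pi_div_two_le_of_le (by linarith) (by linarith)
  have h4 : 1 ≤ ‖s + 1‖ := by
    have := Complex.re_le_norm (s + 1)
    simp at this
    linarith
  have h5 : u = (s - 1) * (s + 1) := by linear_combination -h2
  rw [h5, norm_mul]
  nlinarith [norm_nonneg (s - 1)]

lemma aux_w (γ : ℝ) (hγ : 1/2 < γ) (z : ℂ) :
    (2*γ - 1) * ‖z‖ ≤ ‖z + 2*(γ:ℂ)*conj z‖ := by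
  have h := norm_sub_norm_le (2*(γ:ℂ)*conj z) (-z)
  rw [norm_neg, sub_neg_eq_add, add_comm] at h
  have e : ‖2*(γ:ℂ)*conj z‖ = 2 * γ * ‖z‖ := by
    rw [norm_mul, norm_mul, Complex.norm_real, Complex.norm_conj, Real.norm_eq_abs,
      abs_of_pos (by linarith)]
    simp
  rw [e] at h
  linarith

lemma aux_u (γ : ℝ) (hγ : 1/2 < γ) (z Fz : ℂ) (hz : z ≠ 0)
    (hF : ‖Fz‖ ≤ 4 * ((2*γ - 1)^3 / (2^14 * γ^3)) * ‖z‖ ^ 2) :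
    ‖4*(γ:ℂ)*Fz/(z + 2*(γ:ℂ)*conj z)^2‖ ≤ (2*γ - 1)/(2^10*γ^2) ∧
    ‖4*(γ:ℂ)*Fz/(z + 2*(γ:ℂ)*conj z)^2‖ ≤ 1/1024 := by
  have hw := aux_w γ hγ z
  have hzp : 0 < ‖z‖ := norm_pos_iff.2 hz
  have ha : 0 < 2*γ - 1 := by linarith
  have hg : 0 < γ := by linarith
  have h1 : ‖4*(γ:ℂ)*Fz/(z + 2*(γ:ℂ)*conj z)^2‖ ≤ (2*γ - 1)/(2^10*γ^2) := by
    rw [norm_div, norm_mul, norm_mul, norm_pow, Complex.norm_real, Real.norm_eq_abs,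
      abs_of_pos hg]
    have hp : 0 < (2*γ - 1) * ‖z‖ := by positivity
    calc ‖(4:ℂ)‖ * γ * ‖Fz‖ / ‖z + 2*(γ:ℂ)*conj z‖^2
        ≤ ‖(4:ℂ)‖ * γ * (4 * ((2*γ - 1)^3 / (2^14 * γ^3)) * ‖z‖ ^ 2) / ((2*γ - 1) * ‖z‖)^2 := by
          gcongr
      _ = (2*γ - 1)/(2^10*γ^2) := by
          simp only [Complex.norm_ofNat]
          field_simp
          norm_num
  refine ⟨h1, h1.trans ?_⟩
  rw [div_le_div_iff₀ (by positivity) (by norm_num)]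
  nlinarith [sq_nonneg (γ - 1)]

/-- Norm bounds at a point for the solution of the quadratic equation. -/
lemma aux_f_bound (γ : ℝ) (hγ : 1/2 < γ) (z Fz s : ℂ) (hz : z ≠ 0)
    (hF : ‖Fz‖ ≤ 4 * ((2*γ - 1)^3 / (2^14 * γ^3)) * ‖z‖ ^ 2)
    (hs : s = (1 + 4*(γ:ℂ)*Fz/(z + 2*(γ:ℂ)*conj z)^2) ^ ((1:ℂ)/2)) (fz : ℂ)
    (hf : fz = -((z + 2*(γ:ℂ)*conj z)/(2*(γ:ℂ))) * (1 - s)) :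
    2 * γ * ‖fz‖ ≤ ‖z + 2*(γ:ℂ)*conj z‖ * ((2*γ - 1)/(2^10*γ^2)) ∧
    ‖z + 2*(γ:ℂ)*conj z‖ * (1023/1024) ≤ ‖2*(γ:ℂ)*fz + (z + 2*(γ:ℂ)*conj z)‖ ∧
    (γ:ℂ) * fz^2 + (z + 2*(γ:ℂ)*conj z) * fz = Fz := by
  have hg : 0 < γ := by linarith
  have ha : 0 < 2*γ - 1 := by linarith
  have hgc : (γ:ℂ) ≠ 0 := by exact_mod_cast hg.ne'
  obtain ⟨hu1, hu2⟩ := aux_u γ hγ z Fz hz hF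
  obtain ⟨hs2, hs1⟩ := aux_sqrt _ s hs
  have hw := aux_w γ hγ z
  have hzp : 0 < ‖z‖ := norm_pos_iff.2 hz
  set w := z + 2*(γ:ℂ)*conj z with hwdef
  have hw0 : w ≠ 0 := by
    rw [← norm_pos_iff]
    exact lt_of_lt_of_le (by positivity) hw
  have e1 : 2*(γ:ℂ)*fz = w * (s - 1) := by
    rw [hf]; field_simp; ring
  refine ⟨?_, ?_, ?_⟩
  · have : ‖2*(γ:ℂ)*fz‖ = 2 * γ * ‖fz‖ := by
      rw [norm_mul, norm_mul, Complex.norm_real, Real.norm_eq_abs, abs_of_pos hg]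
      simp
    rw [← this, e1, norm_mul]
    gcongr
    exact hs1.trans hu1
  · rw [e1, show w * (s - 1) + w = w * s by ring, norm_mul]
    gcongr
    have h3 := norm_sub_norm_le (1:ℂ) (1 - s)
    rw [sub_sub_cancel, norm_one, norm_sub_rev] at h3
    linarith
  · have e2 : fz = w * (s - 1) / (2 * γ) := by
      rw [← e1]; field_simp
    have e3 : s^2 * w^2 = w^2 + 4 * γ * Fz := by
      rw [hs2]; field_simp
    rw [e2]
    field_simp
    linear_combination e3

lemma aux_diff (γ : ℝ) (hγ : 1/2 < γ) (F f : ℂ → ℂ)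
    (hfdef : ∀ ζ : ℂ, ζ ≠ 0 → f ζ = -((ζ + 2*(γ:ℂ)*conj ζ)/(2*(γ:ℂ))) *
        (1 - (1 + 4*(γ:ℂ)*F ζ/(ζ + 2*(γ:ℂ)*conj ζ)^2) ^ ((1:ℂ)/2)))
    (z : ℂ) (hz : z ≠ 0) (hFd : DifferentiableAt ℝ F z)
    (hF : ‖F z‖ ≤ 4 * ((2*γ - 1)^3 / (2^14 * γ^3)) * ‖z‖ ^ 2) :
    DifferentiableAt ℝ f z := by
  have hg : 0 < γ := by linarith
  have ha : 0 < 2*γ - 1 := by linarith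
  have hzp : 0 < ‖z‖ := norm_pos_iff.2 hz
  have hw := aux_w γ hγ z
  have hw0 : z + 2*(γ:ℂ)*conj z ≠ 0 := by
    rw [← norm_pos_iff]
    exact lt_of_lt_of_le (by positivity) hw
  obtain ⟨hu1, hu2⟩ := aux_u γ hγ z (F z) hz hF
  have hwd : DifferentiableAt ℝ (fun ζ : ℂ => ζ + 2*(γ:ℂ)*conj ζ) z := by
    have : DifferentiableAt ℝ (fun ζ : ℂ => conj ζ) z :=
      Complex.conjCLE.differentiableAt
    fun_prop
  have hud : DifferentiableAt ℝ (fun ζ : ℂ => 1 + 4*(γ:ℂ)*F ζ/(ζ + 2*(γ:ℂ)*conj ζ)^2) z := by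
    have h2 : (z + 2*(γ:ℂ)*conj z)^2 ≠ 0 := pow_ne_zero _ hw0
    have hd : DifferentiableAt ℝ (fun ζ : ℂ => (ζ + 2*(γ:ℂ)*conj ζ)^2) z := hwd.pow 2
    have hn : DifferentiableAt ℝ (fun ζ : ℂ => 4*(γ:ℂ)*F ζ) z := by fun_prop
    simp only [div_eq_mul_inv]
    exact DifferentiableAt.const_add 1 (hn.mul (hd.fun_inv h2))
  have hsl : 1 + 4*(γ:ℂ)*F z/(z + 2*(γ:ℂ)*conj z)^2 ∈ slitPlane :=
    mem_slitPlane_of_norm_lt_one (lt_of_le_of_lt hu2 (by norm_num))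
  have hsd : DifferentiableAt ℝ
      (fun ζ : ℂ => (1 + 4*(γ:ℂ)*F ζ/(ζ + 2*(γ:ℂ)*conj ζ)^2) ^ ((1:ℂ)/2)) z := by
    have hc : DifferentiableAt ℂ (fun x : ℂ => x ^ ((1:ℂ)/2))
        (1 + 4*(γ:ℂ)*F z/(z + 2*(γ:ℂ)*conj z)^2) :=
      differentiableAt_id.cpow_const hsl
    exact (hc.restrictScalars ℝ).comp z hud
  have hfd : DifferentiableAt ℝ (fun ζ => -((ζ + 2*(γ:ℂ)*conj ζ)/(2*(γ:ℂ))) *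
        (1 - (1 + 4*(γ:ℂ)*F ζ/(ζ + 2*(γ:ℂ)*conj ζ)^2) ^ ((1:ℂ)/2))) z := by
    have h1 : DifferentiableAt ℝ (fun ζ : ℂ => -((ζ + 2*(γ:ℂ)*conj ζ)/(2*(γ:ℂ)))) z := by
      simp only [div_eq_mul_inv]
      exact (hwd.mul_const _).neg
    exact h1.mul (hsd.const_sub 1)
  refine hfd.congr_of_eventuallyEq ?_
  filter_upwards [isOpen_ne.mem_nhds hz] with ζ hζ using hfdef ζ hζ

lemma aux_cont (γ : ℝ) (hγ : 1/2 < γ) (F f : ℂ → ℂ) (S : Set ℂ)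
    (hfdef : ∀ ζ : ℂ, ζ ≠ 0 → f ζ = -((ζ + 2*(γ:ℂ)*conj ζ)/(2*(γ:ℂ))) *
        (1 - (1 + 4*(γ:ℂ)*F ζ/(ζ + 2*(γ:ℂ)*conj ζ)^2) ^ ((1:ℂ)/2)))
    (z : ℂ) (hz : z ≠ 0) (hFd : ContinuousWithinAt F S z)
    (hF : ‖F z‖ ≤ 4 * ((2*γ - 1)^3 / (2^14 * γ^3)) * ‖z‖ ^ 2) :
    ContinuousWithinAt f S z := by
  have hg : 0 < γ := by linarith
  have ha : 0 < 2*γ - 1 := by linarith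
  have hzp : 0 < ‖z‖ := norm_pos_iff.2 hz
  have hw := aux_w γ hγ z
  have hw0 : z + 2*(γ:ℂ)*conj z ≠ 0 := by
    rw [← norm_pos_iff]
    exact lt_of_lt_of_le (by positivity) hw
  obtain ⟨hu1, hu2⟩ := aux_u γ hγ z (F z) hz hF
  have hwd : ContinuousWithinAt (fun ζ : ℂ => ζ + 2*(γ:ℂ)*conj ζ) S z := by
    have : Continuous (fun ζ : ℂ => conj ζ) := Complex.continuous_conj
    exact (by fun_prop : Continuous (fun ζ : ℂ => ζ + 2*(γ:ℂ)*conj ζ)).continuousWithinAt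
  have hud : ContinuousWithinAt (fun ζ : ℂ => 1 + 4*(γ:ℂ)*F ζ/(ζ + 2*(γ:ℂ)*conj ζ)^2) S z := by
    have h2 : (z + 2*(γ:ℂ)*conj z)^2 ≠ 0 := pow_ne_zero _ hw0
    have hd := hwd.pow 2
    have hn : ContinuousWithinAt (fun ζ : ℂ => 4*(γ:ℂ)*F ζ) S z := by fun_prop
    exact continuousWithinAt_const.add (hn.div hd h2)
  have hsl : 1 + 4*(γ:ℂ)*F z/(z + 2*(γ:ℂ)*conj z)^2 ∈ slitPlane :=
    mem_slitPlane_of_norm_lt_one (lt_of_le_of_lt hu2 (by norm_num))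
  have hsd : ContinuousWithinAt
      (fun ζ : ℂ => (1 + 4*(γ:ℂ)*F ζ/(ζ + 2*(γ:ℂ)*conj ζ)^2) ^ ((1:ℂ)/2)) S z :=
    hud.cpow continuousWithinAt_const hsl
  have hfd : ContinuousWithinAt (fun ζ => -((ζ + 2*(γ:ℂ)*conj ζ)/(2*(γ:ℂ))) *
        (1 - (1 + 4*(γ:ℂ)*F ζ/(ζ + 2*(γ:ℂ)*conj ζ)^2) ^ ((1:ℂ)/2))) S z := by
    exact ((hwd.div_const _).neg).mul (continuousWithinAt_const.sub hsd)
  refine hfd.congr_of_eventuallyEq ?_ (hfdef z hz)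
  filter_upwards [mem_nhdsWithin_of_mem_nhds (isOpen_ne.mem_nhds hz)] with ζ hζ using hfdef ζ hζ

/-- The differentiated quadratic equation. -/
lemma aux_implicit (γ : ℝ) (F f : ℂ → ℂ) (z : ℂ) (hFd : DifferentiableAt ℝ F z)
    (hfd : DifferentiableAt ℝ f z)
    (hq : ∀ᶠ ζ in nhds z, (γ:ℂ) * f ζ^2 + (ζ + 2*(γ:ℂ)*conj ζ) * f ζ = F ζ) (v : ℂ) :
    (2*(γ:ℂ)*f z + (z + 2*(γ:ℂ)*conj z)) * fderiv ℝ f z v =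
      fderiv ℝ F z v - f z * (v + 2*(γ:ℂ)*conj v) := by
  have hc : HasFDerivAt (fun ζ : ℂ => conj ζ) (Complex.conjCLE : ℂ →L[ℝ] ℂ) z :=
    Complex.conjCLE.hasFDerivAt
  have h1 := ((hfd.hasFDerivAt.pow 2).const_mul (γ:ℂ)).add
    (((hasFDerivAt_id (𝕜 := ℝ) z).add (hc.const_mul (2*(γ:ℂ)))).mul hfd.hasFDerivAt)
  have h2 := (h1.congr_of_eventuallyEq (f₁ := F) (by
    filter_upwards [hq] with ζ hζ
    simp [← hζ])).unique hFd.hasFDerivAt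
  have h3 := congrArg (fun L : ℂ →L[ℝ] ℂ => L v) h2
  simp at h3
  linear_combination h3

lemma aux_wirt (γ : ℝ) (hγ : 1/2 < γ) (zn wn fn D X Y : ℝ) (hX : 0 ≤ X)
    (hw : (2*γ - 1) * zn ≤ wn) (hwp : 0 < wn)
    (h1 : 2 * γ * fn ≤ wn * ((2*γ - 1)/(2^10*γ^2)))
    (h2 : wn * (1023/1024) ≤ D)
    (hY : Y ≤ 2 * ((2*γ - 1)^3 / (2^14 * γ^3)) * zn)
    (h : D * X ≤ Y + 2 * γ * fn) : X ≤ (2*γ - 1)/(2^9 * γ^2) := by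
  have hg : 0 < γ := by linarith
  have ha : 0 < 2*γ - 1 := by linarith
  have hQ : 0 < (2*γ - 1)/γ^2 := by positivity
  have hB : 2 * ((2*γ - 1)^3 / (2^14 * γ^3)) * zn ≤ wn * (4 / 2^14 * ((2*γ - 1)/γ^2)) := by
    have e : 2 * ((2*γ - 1)^3 / (2^14 * γ^3)) * zn =
      (2 / 2^14 * ((2*γ - 1)/γ^2)) * ((2*γ - 1) / γ) * ((2*γ - 1) * zn) := by
      field_simp
    rw [e]
    have h5 : (2*γ - 1) / γ ≤ 2 := by
      rw [div_le_iff₀ hg]; linarith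
    calc _ ≤ (2 / 2^14 * ((2*γ - 1)/γ^2)) * ((2*γ - 1) / γ) * wn := by gcongr
      _ ≤ (2 / 2^14 * ((2*γ - 1)/γ^2)) * 2 * wn := by gcongr
      _ = _ := by ring
  have e1 : (2*γ - 1)/(2^10*γ^2) = ((2*γ - 1)/γ^2) / 2^10 := by field_simp
  have e2 : (2*γ - 1)/(2^9*γ^2) = ((2*γ - 1)/γ^2) / 2^9 := by field_simp
  rw [e1] at h1
  rw [e2]
  set Q := (2*γ - 1)/γ^2
  have h6 : wn * (1023/1024) * X ≤ D * X := by gcongr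
  have h7 : wn * ((1023/1024) * X) ≤ wn * (20 / 2^14 * Q) := by nlinarith
  have h8 := le_of_mul_le_mul_left h7 hwp
  norm_num at h8 ⊢
  linarith

/-- Let `γ > 1/2`, `r > 0`, and let `F` be smooth on `D̄_r(0)` with
`F(0) = 0`, vanishing first partials at `0`, and `‖F‖_{C²} ≤ (2γ−1)³/(2¹⁴γ³)`. Let `f` be the
branch `f(ζ) = −((ζ + 2γζ̄)/(2γ))(1 − √(1 + 4γF(ζ)/(ζ + 2γζ̄)²))` for `ζ ≠ 0` (principal
square root, via `cpow`) and `f(0) = 0` of the quadratic `γf² + (ζ + 2γζ̄)f − F = 0`. Then the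
Wirtinger derivatives of `f` satisfy `|f_z|, |f_{z̄}| ≤ (2γ−1)/(2⁹γ²)` for `0 < |ζ| < r`, and
`f` is Lipschitz on `D̄_r(0)` with constant `(2γ−1)/(32γ²)`. -/
theorem wirtinger_bounds_and_lipschitz_of_solution (γ r : ℝ) (hγ : 1/2 < γ) (hr : 0 < r)
    (F : ℂ → ℂ) (hF : ContDiffOn ℝ (⊤ : ℕ∞) F (closedBall (0 : ℂ) r))
    (hF0 : F 0 = 0) (hFx : pd 1 F 0 = 0) (hFy : pd Complex.I F 0 = 0)
    (hB : IsC2Bound F (closedBall (0 : ℂ) r) ((2*γ - 1)^3 / (2^14 * γ^3)))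
    (f : ℂ → ℂ) (hf0 : f 0 = 0)
    (hfdef : ∀ ζ : ℂ, ζ ≠ 0 → f ζ = -((ζ + 2*(γ:ℂ)*conj ζ)/(2*(γ:ℂ))) *
        (1 - (1 + 4*(γ:ℂ)*F ζ/(ζ + 2*(γ:ℂ)*conj ζ)^2) ^ ((1:ℂ)/2))) :
    (∀ ζ : ℂ, 0 < ‖ζ‖ → ‖ζ‖ < r →
      ‖(pd 1 f ζ - Complex.I * pd Complex.I f ζ) / 2‖ ≤ (2*γ - 1)/(2^9 * γ^2) ∧
      ‖(pd 1 f ζ + Complex.I * pd Complex.I f ζ) / 2‖ ≤ (2*γ - 1)/(2^9 * γ^2)) ∧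
    (∀ ζ₁ ∈ closedBall (0 : ℂ) r, ∀ ζ₂ ∈ closedBall (0 : ℂ) r,
      ‖f ζ₁ - f ζ₂‖ ≤ ((2*γ - 1)/(32*γ^2)) * ‖ζ₁ - ζ₂‖) := by

  have hg : 0 < γ := by linarith
  have ha : 0 < 2*γ - 1 := by linarith
  have hB0 : 0 ≤ (2*γ - 1)^3 / (2^14 * γ^3) := by positivity
  have hX : ∀ z ∈ ball (0:ℂ) r, ‖pd 1 F z‖ ≤ 2 * ((2*γ - 1)^3 / (2^14 * γ^3)) * ‖z‖ :=
    aux_pd_bound F r _ hr hF 1 hFx (fun z hz => (hB z hz).2.2.2.1)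
      (fun z hz => (hB z hz).2.2.2.2.1)
  have hY : ∀ z ∈ ball (0:ℂ) r, ‖pd Complex.I F z‖ ≤ 2 * ((2*γ - 1)^3 / (2^14 * γ^3)) * ‖z‖ :=
    aux_pd_bound F r _ hr hF Complex.I hFy (fun z hz => (hB z hz).2.2.2.2.2.1)
      (fun z hz => (hB z hz).2.2.2.2.2.2)
  have hFb := aux_F_bound F r _ hr hF hF0 hX hY hB0
  have hFd : ∀ z ∈ ball (0:ℂ) r, DifferentiableAt ℝ F z := fun z hz =>
    (hF.contDiffAt (Filter.mem_of_superset (isOpen_ball.mem_nhds hz)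
      ball_subset_closedBall)).differentiableAt (by simp)
  have hfd : ∀ z ∈ ball (0:ℂ) r, z ≠ 0 → DifferentiableAt ℝ f z := fun z hz hz0 =>
    aux_diff γ hγ F f hfdef z hz0 (hFd z hz) (hFb z (ball_subset_closedBall hz))
  have hfb : ∀ z ∈ closedBall (0:ℂ) r, z ≠ 0 → _ := fun z hz hz0 =>
    aux_f_bound γ hγ z (F z) _ hz0 (hFb z hz) rfl (f z) (hfdef z hz0)
  have hwirt : ∀ ζ : ℂ, 0 < ‖ζ‖ → ‖ζ‖ < r →
      ‖(pd 1 f ζ - Complex.I * pd Complex.I f ζ) / 2‖ ≤ (2*γ - 1)/(2^9 * γ^2) ∧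
      ‖(pd 1 f ζ + Complex.I * pd Complex.I f ζ) / 2‖ ≤ (2*γ - 1)/(2^9 * γ^2) := by
    intro z hz0' hzr
    have hz0 : z ≠ 0 := norm_pos_iff.1 hz0'
    have hz : z ∈ ball (0:ℂ) r := by simpa using hzr
    have hq : ∀ᶠ ζ in nhds z, (γ:ℂ) * f ζ^2 + (ζ + 2*(γ:ℂ)*conj ζ) * f ζ = F ζ := by
      filter_upwards [isOpen_ne.mem_nhds hz0, isOpen_ball.mem_nhds hz] with ζ h1 h2
      exact (hfb ζ (ball_subset_closedBall h2) h1).2.2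
    have him := aux_implicit γ F f z (hFd z hz) (hfd z hz hz0) hq
    have i1 := him 1
    have i2 := him Complex.I
    obtain ⟨b1, b2, -⟩ := hfb z (ball_subset_closedBall hz) hz0
    have hw := aux_w γ hγ z
    have hwp : 0 < ‖z + 2*(γ:ℂ)*conj z‖ := lt_of_lt_of_le (by positivity) hw
    have hx := hX z hz
    have hy := hY z hz
    simp only [map_one, Complex.conj_I] at i1 i2
    have hI : Complex.I * Complex.I = -1 := Complex.I_mul_I
    constructor
    · refine aux_wirt γ hγ ‖z‖ _ ‖f z‖ _ _ ‖(pd 1 F z - Complex.I * pd Complex.I F z) / 2‖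
        (norm_nonneg _) hw hwp b1 b2 ?_ ?_
      · rw [norm_div]
        have := norm_sub_le (pd 1 F z) (Complex.I * pd Complex.I F z)
        rw [norm_mul, Complex.norm_I, one_mul] at this
        simp only [Complex.norm_ofNat]
        linarith
      · rw [← norm_mul]
        have e : (2*(γ:ℂ)*f z + (z + 2*(γ:ℂ)*conj z)) *
            ((pd 1 f z - Complex.I * pd Complex.I f z) / 2) =
            (pd 1 F z - Complex.I * pd Complex.I F z) / 2 - f z := by
          unfold pd
          linear_combination i1 / 2 - Complex.I * i2 / 2 + f z * (1 - 2 * γ) / 2 * hI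
        rw [e]
        refine (norm_sub_le _ _).trans ?_
        nlinarith [norm_nonneg (f z)]
    · refine aux_wirt γ hγ ‖z‖ _ ‖f z‖ _ _ ‖(pd 1 F z + Complex.I * pd Complex.I F z) / 2‖
        (norm_nonneg _) hw hwp b1 b2 ?_ ?_
      · rw [norm_div]
        have := norm_add_le (pd 1 F z) (Complex.I * pd Complex.I F z)
        rw [norm_mul, Complex.norm_I, one_mul] at this
        simp only [Complex.norm_ofNat]
        linarith
      · rw [← norm_mul]
        have e : (2*(γ:ℂ)*f z + (z + 2*(γ:ℂ)*conj z)) *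
            ((pd 1 f z + Complex.I * pd Complex.I f z) / 2) =
            (pd 1 F z + Complex.I * pd Complex.I F z) / 2 - 2 * (γ:ℂ) * f z := by
          unfold pd
          linear_combination i1 / 2 + Complex.I * i2 / 2 - f z * (1 - 2 * γ) / 2 * hI
        rw [e]
        refine (norm_sub_le _ _).trans ?_
        rw [norm_mul, norm_mul, Complex.norm_real, Real.norm_eq_abs, abs_of_pos hg]
        simp
  refine ⟨hwirt, ?_⟩
  have hQ : 0 < (2*γ - 1)/γ^2 := by positivity
  have eK : (2*γ - 1)/(32*γ^2) = (2*γ - 1)/γ^2 / 32 := by field_simp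
  have e9 : (2*γ - 1)/(2^9*γ^2) = (2*γ - 1)/γ^2 / 2^9 := by field_simp
  have e10 : (2*γ - 1)/(2^10*γ^2) = (2*γ - 1)/γ^2 / 2^10 := by field_simp
  have hlin : ∀ z ∈ closedBall (0:ℂ) r, ‖f z‖ ≤ ((2*γ - 1)/(32*γ^2)) * ‖z‖ := by
    intro z hz
    by_cases hz0 : z = 0
    · simp [hz0, hf0]
    obtain ⟨b1, -, -⟩ := hfb z hz hz0
    have hw : ‖z + 2*(γ:ℂ)*conj z‖ ≤ 4 * γ * ‖z‖ := by
      refine (norm_add_le _ _).trans ?_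
      rw [norm_mul, norm_mul, Complex.norm_real, Complex.norm_conj, Real.norm_eq_abs,
        abs_of_pos hg]
      simp only [Complex.norm_ofNat]
      nlinarith [norm_nonneg z]
    rw [e10] at b1
    rw [eK]
    have h3 : 2 * γ * ‖f z‖ ≤ 2 * γ * ((2*γ - 1)/γ^2 / 32 * ‖z‖) := by
      refine b1.trans ?_
      have := mul_le_mul_of_nonneg_right hw hQ.le
      have hp : 0 ≤ γ * ‖z‖ * ((2*γ - 1)/γ^2) := by positivity
      norm_num at this ⊢
      linarith
    exact le_of_mul_le_mul_left h3 (by positivity)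
  have hop : ∀ z ∈ ball (0:ℂ) r, z ≠ 0 → ‖fderiv ℝ f z‖ ≤ (2*γ - 1)/(32*γ^2) := by
    intro z hz hz0
    obtain ⟨c1, c2⟩ := hwirt z (norm_pos_iff.2 hz0) (by simpa using hz)
    rw [e9] at c1 c2
    rw [eK]
    have d1 : ‖fderiv ℝ f z 1‖ ≤ 2 * ((2*γ - 1)/γ^2 / 2^9) := by
      have e : fderiv ℝ f z 1 = (pd 1 f z - Complex.I * pd Complex.I f z) / 2 +
        (pd 1 f z + Complex.I * pd Complex.I f z) / 2 := by unfold pd; ring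
      rw [e]
      refine (norm_add_le _ _).trans ?_
      linarith
    have d2 : ‖fderiv ℝ f z Complex.I‖ ≤ 2 * ((2*γ - 1)/γ^2 / 2^9) := by
      have e : Complex.I * fderiv ℝ f z Complex.I =
        (pd 1 f z + Complex.I * pd Complex.I f z) / 2 -
        (pd 1 f z - Complex.I * pd Complex.I f z) / 2 := by unfold pd; ring
      have e' : ‖fderiv ℝ f z Complex.I‖ = ‖Complex.I * fderiv ℝ f z Complex.I‖ := by
        rw [norm_mul, Complex.norm_I, one_mul]
      rw [e', e]
      refine (norm_sub_le _ _).trans ?_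
      linarith
    have := aux_opnorm _ _ d1 d2
    norm_num at this ⊢
    linarith
  have hopen : ∀ z₁ ∈ ball (0:ℂ) r, ∀ z₂ ∈ ball (0:ℂ) r,
      ‖f z₁ - f z₂‖ ≤ ((2*γ - 1)/(32*γ^2)) * ‖z₁ - z₂‖ := by
    intro z₁ h₁ z₂ h₂
    by_cases h0 : (0:ℂ) ∈ segment ℝ z₁ z₂
    · have hd := dist_add_dist_of_mem_segment h0
      rw [dist_zero_right, dist_zero_left, dist_eq_norm] at hd
      rw [← hd]
      refine (norm_sub_le _ _).trans ?_
      have l1 := hlin z₁ (ball_subset_closedBall h₁)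
      have l2 := hlin z₂ (ball_subset_closedBall h₂)
      linarith
    · have hsub : segment ℝ z₁ z₂ ⊆ ball (0:ℂ) r := (convex_ball (0:ℂ) r).segment_subset h₁ h₂
      have hne : ∀ x ∈ segment ℝ z₁ z₂, x ≠ 0 := fun x hx hx0 => h0 (hx0 ▸ hx)
      exact (convex_segment z₁ z₂).norm_image_sub_le_of_norm_fderiv_le (𝕜 := ℝ)
        (fun x hx => hfd x (hsub hx) (hne x hx)) (fun x hx => hop x (hsub hx) (hne x hx))
        (right_mem_segment ℝ z₁ z₂) (left_mem_segment ℝ z₁ z₂)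
  have hcont : ContinuousOn f (closedBall (0:ℂ) r) := by
    intro z hz
    by_cases hz0 : z = 0
    · subst hz0
      unfold ContinuousWithinAt
      rw [hf0]
      refine squeeze_zero_norm' (a := fun z : ℂ => ((2*γ - 1)/(32*γ^2)) * ‖z‖) ?_ ?_
      · filter_upwards [self_mem_nhdsWithin] with z hz using hlin z hz
      · have hc : Continuous (fun z : ℂ => ((2*γ - 1)/(32*γ^2)) * ‖z‖) := by fun_prop
        have := hc.tendsto 0
        simp only [norm_zero, mul_zero] at this
        exact this.mono_left nhdsWithin_le_nhds
    · exact aux_cont γ hγ F f _ hfdef z hz0 (hF.continuousOn z hz) (hFb z hz)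
  have hK : 0 ≤ (2*γ - 1)/(32*γ^2) := by positivity
  have hL : LipschitzOnWith ⟨_, hK⟩ f (ball (0:ℂ) r) :=
    LipschitzOnWith.of_dist_le_mul fun x hx y hy => by
      rw [dist_eq_norm, dist_eq_norm]
      exact hopen x hx y hy
  have hL' := (lipschitzOnWith_closure_iff
    (by rw [closure_ball (0:ℂ) hr.ne']; exact hcont)).2 hL
  rw [closure_ball (0:ℂ) hr.ne'] at hL'
  intro z₁ h₁ z₂ h₂
  have := hL'.dist_le_mul z₁ h₁ z₂ h₂
  rw [dist_eq_norm, dist_eq_norm] at this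
  exact this
end
end
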